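/- Let N be a nilpotent endomorphism of V and let S ∈ E_{≥3}V^N_*. Then Ñ = N + S is nilpotent and V^{Ñ}_{≥a} = V^N_{≥a} for every a ∈ ℤ. -/

import Mathlib

/-- The canonical (Dynkin–Kostant) filtration attached to a nilpotent endomorphism:
`V^N_{≥a} = Σ_{j ≥ max(0,a)} N^j (ker N^{2j−a+1})`. -/
noncomputable def canonFilt {k : Type*} [Field k] {V : Type*} [AddCommGroup V] [Module k V]
    (N : V →ₗ[k] V) (a : ℤ) : Submodule k V :=
  ⨆ j : {j : ℕ // a ≤ (j : ℤ)},
    Submodule.map (N ^ (j : ℕ)) (LinearMap.ker (N ^ (2 * ((j : ℕ) : ℤ) - a + 1).toNat))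

section

variable {k : Type*} [Field k] {V : Type*} [AddCommGroup V] [Module k V] {N S : V →ₗ[k] V}

/-- The filtration `F` is bounded, `N` raises degrees by two, and `N ^ m` induces an isomorphism
`gr_{-m} F ≃ gr_m F` for all `m ≥ 0`. -/
structure IsMonodromyFiltration (N : V →ₗ[k] V) (F : ℤ → Submodule k V) : Prop where
  antitone : Antitone F
  exists_eq_bot : ∃ n : ℕ, F n = ⊥
  exists_eq_top : ∃ n : ℕ, F (-n) = ⊤
  apply_mem : ∀ {a : ℤ} {x : V}, x ∈ F a → N x ∈ F (a + 2)
  exists_sub_mem : ∀ (m : ℕ) {x : V}, x ∈ F m → ∃ y ∈ F (-m), x - (N ^ m) y ∈ F (m + 1)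
  mem_of_pow_mem : ∀ (m : ℕ) {x : V}, x ∈ F (-m) → (N ^ m) x ∈ F (m + 1) → x ∈ F (-m + 1)

theorem pow_apply_mem {F : ℤ → Submodule k V}
    (h : ∀ {a : ℤ} {x : V}, x ∈ F a → N x ∈ F (a + 2)) (j : ℕ) {a : ℤ} {x : V} (hx : x ∈ F a) :
    (N ^ j) x ∈ F (a + 2 * j) := by
  induction j with
  | zero => simpa using hx
  | succ j ih =>
    rw [pow_succ', Module.End.mul_apply]
    convert h ih using 2
    push_cast
    ring

theorem ker_pow_mono {m n : ℕ} (h : m ≤ n) {x : V} (hx : (N ^ m) x = 0) : (N ^ n) x = 0 := by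
  obtain ⟨d, rfl⟩ := Nat.exists_eq_add_of_le' h
  rw [pow_add, Module.End.mul_apply, hx, map_zero]

theorem pow_apply_mem_canonFilt {a : ℤ} {j n : ℕ} (hj : a ≤ j) (hn : (n : ℤ) ≤ 2 * j - a + 1)
    {x : V} (hx : (N ^ n) x = 0) : (N ^ j) x ∈ canonFilt N a := by
  refine Submodule.mem_iSup_of_mem (⟨j, hj⟩ : {j : ℕ // a ≤ (j : ℤ)})
    (Submodule.mem_map_of_mem (LinearMap.mem_ker.2 (ker_pow_mono ?_ hx)))
  dsimp only
  omega

theorem canonFilt_le {a : ℤ} {P : Submodule k V}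
    (h : ∀ (j n : ℕ) (x : V), a ≤ j → (n : ℤ) = 2 * j - a + 1 → (N ^ n) x = 0 → (N ^ j) x ∈ P) :
    canonFilt N a ≤ P := by
  refine iSup_le ?_
  rintro ⟨j, hj⟩
  rw [Submodule.map_le_iff_le_comap]
  intro x hx
  exact h j _ x hj (Int.toNat_of_nonneg (by omega)) hx

theorem canonFilt_antitone : Antitone (canonFilt N) := fun _ _ hab =>
  canonFilt_le fun _ _ _ hj hn hx => pow_apply_mem_canonFilt (by omega) (by omega) hx

theorem apply_mem_canonFilt {a : ℤ} {x : V} (hx : x ∈ canonFilt N a) :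
    N x ∈ canonFilt N (a + 2) := by
  suffices h : canonFilt N a ≤ (canonFilt N (a + 2)).comap N from h hx
  refine canonFilt_le fun j n y hj hn hy => ?_
  rw [Submodule.mem_comap, ← Module.End.mul_apply, ← pow_succ']
  rcases hj.eq_or_lt with rfl | hj
  · rw [ker_pow_mono (by omega) hy]
    exact zero_mem _
  · exact pow_apply_mem_canonFilt (by push_cast; omega) (by push_cast; omega) hy

theorem canonFilt_le_map_pow (m : ℕ) : canonFilt N m ≤ (canonFilt N (-m)).map (N ^ m) := by
  refine canonFilt_le fun j n x hj hn hx => ?_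
  obtain ⟨d, rfl⟩ := Nat.exists_eq_add_of_le (Int.ofNat_le.1 hj)
  refine ⟨(N ^ d) x, pow_apply_mem_canonFilt (by omega) (by push_cast at hn; omega) hx, ?_⟩
  rw [pow_add, Module.End.mul_apply]

theorem isMonodromyFiltration_canonFilt (hN : IsNilpotent N) :
    IsMonodromyFiltration N (canonFilt N) where
  antitone := canonFilt_antitone
  exists_eq_bot := by
    obtain ⟨n, hn⟩ := hN
    refine ⟨n, eq_bot_iff.2 (canonFilt_le fun j _ x hj _ _ => ?_)⟩
    rw [pow_eq_zero_of_le (Int.ofNat_le.1 hj) hn]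
    exact zero_mem _
  exists_eq_top := by
    obtain ⟨n, hn⟩ := hN
    refine ⟨n, eq_top_iff.2 fun x _ => ?_⟩
    exact pow_apply_mem_canonFilt (N := N) (j := 0) (n := n) (x := x) (by simp)
      (by push_cast; omega) (by rw [hn]; rfl)
  apply_mem := apply_mem_canonFilt
  exists_sub_mem m x hx := by
    obtain ⟨y, hy, rfl⟩ := canonFilt_le_map_pow m hx
    exact ⟨y, hy, by simp⟩
  mem_of_pow_mem m x _ hx := by
    obtain ⟨y, hy, hxy⟩ := canonFilt_le_map_pow (N := N) (m + 1) (by exact_mod_cast hx)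
    have hker : (N ^ m) (x - N y) = 0 := by
      rw [map_sub, ← hxy, pow_succ, Module.End.mul_apply, sub_self]
    have hsub : x - N y ∈ canonFilt N (-m + 1) := by
      rcases m.eq_zero_or_pos with rfl | hm
      · rw [pow_zero, Module.End.one_apply] at hker
        rw [hker]
        exact zero_mem _
      · exact pow_apply_mem_canonFilt (j := 0) (by push_cast; omega) (by push_cast; omega) hker
    have hNy : N y ∈ canonFilt N (-m + 1) := by
      convert apply_mem_canonFilt hy using 2
      push_cast
      ring
    simpa using add_mem hsub hNy

namespace IsMonodromyFiltration

variable {F : ℤ → Submodule k V}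

theorem isNilpotent (h : IsMonodromyFiltration N F) : IsNilpotent N := by
  obtain ⟨p, hp⟩ := h.exists_eq_bot
  obtain ⟨q, hq⟩ := h.exists_eq_top
  refine ⟨p + q, LinearMap.ext fun x => ?_⟩
  have hx : x ∈ F (-q) := hq ▸ Submodule.mem_top
  have hmem := h.antitone (show (p : ℤ) ≤ -q + 2 * (p + q : ℕ) by push_cast; omega)
    (pow_apply_mem h.apply_mem (p + q) hx)
  rwa [hp, Submodule.mem_bot] at hmem

theorem le_map_pow (h : IsMonodromyFiltration N F) (m : ℕ) :
    F m ≤ (F (-m)).map (N ^ m) := by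
  obtain ⟨p, hp⟩ := h.exists_eq_bot
  obtain hm | hm := le_total p m
  · exact ((h.antitone (Int.ofNat_le.2 hm)).trans hp.le).trans bot_le
  induction hm using Nat.decreasingInduction with
  | self => exact hp.le.trans bot_le
  | of_succ m _ ih =>
    intro x hx
    obtain ⟨y, hy, hxy⟩ := h.exists_sub_mem m hx
    obtain ⟨z, hz, hzx⟩ := ih (by exact_mod_cast hxy)
    refine ⟨N z + y, add_mem (h.antitone (by push_cast; omega) (h.apply_mem hz)) hy, ?_⟩
    rw [map_add, ← Module.End.mul_apply, ← pow_succ, hzx, sub_add_cancel]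

theorem mem_of_pow_apply_eq_zero (h : IsMonodromyFiltration N F) {m : ℕ} {x : V}
    (hx : (N ^ (m + 1)) x = 0) : x ∈ F (-m) := by
  obtain ⟨q, hq⟩ := h.exists_eq_top
  have key : ∀ n : ℕ, x ∈ F (-(m + n : ℕ)) → x ∈ F (-m) := by
    intro n
    induction n with
    | zero => exact id
    | succ n ih =>
      refine fun hn => ih ?_
      have := h.mem_of_pow_mem _ hn (by rw [ker_pow_mono (by omega) hx]; exact zero_mem _)
      convert this using 2
      push_cast
      ring
  refine key q (h.antitone (show -((m + q : ℕ) : ℤ) ≤ -q by push_cast; omega) ?_)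
  rw [hq]
  exact Submodule.mem_top

theorem canonFilt_le (h : IsMonodromyFiltration N F) (a : ℤ) : canonFilt N a ≤ F a := by
  refine _root_.canonFilt_le fun j n x hj hn hx => ?_
  obtain ⟨m, rfl⟩ : ∃ m, n = m + 1 := Nat.exists_eq_succ_of_ne_zero (by omega)
  convert pow_apply_mem h.apply_mem j (h.mem_of_pow_apply_eq_zero hx) using 2
  push_cast at hn
  omega

theorem neg_le_canonFilt (h : IsMonodromyFiltration N F) (m : ℕ) :
    F (-m) ≤ canonFilt N (-m) := by
  obtain ⟨n, hn⟩ := h.isNilpotent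
  have key : ∀ d m : ℕ, n ≤ m + d → F (-m) ≤ canonFilt N (-m) := by
    intro d
    induction d with
    | zero =>
      intro m hm x _
      exact pow_apply_mem_canonFilt (N := N) (j := 0) (n := n) (by simp) (by push_cast; omega)
        (by rw [hn]; rfl)
    | succ d ih =>
      intro m hm x hx
      have hpow : (N ^ (m + 1)) x ∈ F (m + 2 : ℕ) := by
        convert pow_apply_mem h.apply_mem (m + 1) hx using 2
        push_cast
        ring
      obtain ⟨y, hy, hyx⟩ := h.le_map_pow _ hpow
      have hker : (N ^ (m + 1)) (x - N y) = 0 := by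
        rw [map_sub, ← hyx, pow_succ _ (m + 1), Module.End.mul_apply, sub_self]
      have hsub : x - N y ∈ canonFilt N (-m) :=
        pow_apply_mem_canonFilt (j := 0) (by simp) (by push_cast; omega) hker
      have hNy : N y ∈ canonFilt N (-m) := by
        convert apply_mem_canonFilt (ih (m + 2) (by omega) hy) using 2
        push_cast
        ring
      simpa using add_mem hsub hNy
  exact key n m (by omega)

/-- A nilpotent endomorphism has at most one monodromy filtration. -/
theorem eq_canonFilt (h : IsMonodromyFiltration N F) (a : ℤ) : F a = canonFilt N a := by
  refine le_antisymm ?_ (h.canonFilt_le a)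
  obtain ⟨m, rfl | rfl⟩ := a.eq_nat_or_neg
  · intro x hx
    obtain ⟨y, hy, rfl⟩ := h.le_map_pow m hx
    convert pow_apply_mem (F := canonFilt N) apply_mem_canonFilt m (h.neg_le_canonFilt m hy) using 2
    ring
  · exact h.neg_le_canonFilt m

theorem add_apply_mem (h : IsMonodromyFiltration N F)
    (hS : ∀ a : ℤ, ∀ x ∈ F a, S x ∈ F (a + 3)) {a : ℤ} {x : V} (hx : x ∈ F a) :
    (N + S) x ∈ F (a + 2) :=
  add_mem (h.apply_mem hx) (h.antitone (by omega) (hS a x hx))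

theorem add_pow_sub_pow_mem (h : IsMonodromyFiltration N F)
    (hS : ∀ a : ℤ, ∀ x ∈ F a, S x ∈ F (a + 3)) (m : ℕ) {a : ℤ} {x : V} (hx : x ∈ F a) :
    ((N + S) ^ m) x - (N ^ m) x ∈ F (a + 2 * m + 1) := by
  induction m with
  | zero => simp
  | succ m ih =>
    have h₁ := h.add_apply_mem hS ih
    have h₂ := hS _ _ (pow_apply_mem h.apply_mem m hx)
    have heq : ((N + S) ^ (m + 1)) x - (N ^ (m + 1)) x =
        (N + S) (((N + S) ^ m) x - (N ^ m) x) + S ((N ^ m) x) := by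
      rw [pow_succ', pow_succ', Module.End.mul_apply, Module.End.mul_apply, map_sub,
        LinearMap.add_apply N S ((N ^ m) x)]
      abel
    rw [heq]
    exact add_mem (h.antitone (by push_cast; omega) h₁) (h.antitone (by push_cast; omega) h₂)

theorem add (h : IsMonodromyFiltration N F) (hS : ∀ a : ℤ, ∀ x ∈ F a, S x ∈ F (a + 3)) :
    IsMonodromyFiltration (N + S) F where
  antitone := h.antitone
  exists_eq_bot := h.exists_eq_bot
  exists_eq_top := h.exists_eq_top
  apply_mem := h.add_apply_mem hS
  exists_sub_mem m x hx := by
    obtain ⟨y, hy, hxy⟩ := h.exists_sub_mem m hx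
    refine ⟨y, hy, ?_⟩
    have hdiff := h.antitone (show (m : ℤ) + 1 ≤ -m + 2 * m + 1 by omega)
      (h.add_pow_sub_pow_mem hS m hy)
    simpa using sub_mem hxy hdiff
  mem_of_pow_mem m x hx hxm := by
    refine h.mem_of_pow_mem m hx ?_
    have hdiff := h.antitone (show (m : ℤ) + 1 ≤ -m + 2 * m + 1 by omega)
      (h.add_pow_sub_pow_mem hS m hx)
    simpa using sub_mem hxm hdiff

end IsMonodromyFiltration

end

/-- if `S ∈ E_{≥3}V^N_*` then `Ñ = N + S` is nilpotent and has the same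
canonical filtration as `N`. -/
theorem stmt_7
    (k : Type*) [Field k] (V : Type*) [AddCommGroup V] [Module k V]
    [FiniteDimensional k V]
    (N : V →ₗ[k] V) (hN : IsNilpotent N)
    (S : V →ₗ[k] V)
    (hS : ∀ a : ℤ, ∀ x ∈ canonFilt N a, S x ∈ canonFilt N (a + 3)) :
    IsNilpotent (N + S) ∧ ∀ a : ℤ, canonFilt (N + S) a = canonFilt N a := by
  have hF := isMonodromyFiltration_canonFilt hN
  have hF' := hF.add hS
  exact ⟨hF'.isNilpotent, fun a => (hF'.eq_canonFilt a).symm⟩
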